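/- Let d ≥ 2 be an integer, let 1 < q < 2, and let x₁,…,x_d be nonnegative reals with ∑ᵢ xᵢ = 1. Then 1 − ∑ᵢ xᵢ^q ≥ ((1 − d^{1−q})/(d−1)²) · ((∑ᵢ √xᵢ)² − 1)². -/

import Mathlib

lemma off_diag {d : ℕ} (f : Fin d → Fin d → ℝ) :
    ∑ p : Fin d × Fin d, (if p.1 = p.2 then 0 else f p.1 p.2) =
      ∑ i, ∑ j, f i j - ∑ i, f i i := by
  rw [Fintype.sum_prod_type, ← Finset.sum_sub_distrib]
  refine Finset.sum_congr rfl fun i _ => ?_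
  have : ∀ j, (if i = j then 0 else f i j) = f i j - (if i = j then f i j else 0) := by
    intro j; split_ifs <;> simp
  simp only [this, Finset.sum_sub_distrib]
  simp

lemma key_cs (d : ℕ) (x : Fin d → ℝ) (hx : ∀ i, 0 ≤ x i) (hsum : ∑ i, x i = 1)
    (s : ℝ) (hs : 0 < s) :
    ((∑ i, Real.sqrt (x i)) ^ 2 - 1) ^ 2 ≤
      (∑ i, x i * (1 - x i) / (x i + s)) * (((d : ℝ) - 1) * (1 + d * s)) := by
  have h := Finset.sum_sq_le_sum_mul_sum_of_sq_eq_mul (Finset.univ : Finset (Fin d × Fin d))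
    (r := fun p => if p.1 = p.2 then 0 else √(x p.1) * √(x p.2))
    (f := fun p => if p.1 = p.2 then 0 else x p.1 / (x p.1 + s) * x p.2)
    (g := fun p => if p.1 = p.2 then 0 else x p.1 + s)
    (by
      intro p _
      have := hx p.1
      have := hx p.2
      split_ifs <;> positivity)
    (by
      intro p _
      have := hx p.1
      split_ifs <;> positivity)
    (by
      intro p _
      have h1 := hx p.1
      have h2 := hx p.2
      split_ifs
      · simp
      · rw [mul_pow, Real.sq_sqrt h1, Real.sq_sqrt h2]
        field_simp)
  rw [off_diag (fun i j => √(x i) * √(x j)), off_diag (fun i j => x i / (x i + s) * x j),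
    off_diag (fun i j => x i + s)] at h
  have e1 : ∑ i, ∑ j, √(x i) * √(x j) - ∑ i, √(x i) * √(x i) = (∑ i, √(x i)) ^ 2 - 1 := by
    rw [← Finset.sum_mul_sum, ← sq]
    simp only [Real.mul_self_sqrt (hx _), hsum]
  have e2 : ∑ i, ∑ j, x i / (x i + s) * x j - ∑ i, x i / (x i + s) * x i
      = ∑ i, x i * (1 - x i) / (x i + s) := by
    simp only [← Finset.mul_sum, hsum]
    rw [← Finset.sum_sub_distrib]
    refine Finset.sum_congr rfl fun i _ => ?_
    ring
  have e3 : ∑ i : Fin d, ∑ j : Fin d, (x i + s) - ∑ i, (x i + s)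
      = ((d : ℝ) - 1) * (1 + d * s) := by
    simp only [Finset.sum_const, Finset.card_univ, Fintype.card_fin, nsmul_eq_mul,
      ← Finset.mul_sum, Finset.sum_add_distrib, hsum]
    ring
  rwa [e1, e2, e3] at h

open MeasureTheory Set in
theorem stmt_0 (d : ℕ) (hd : 2 ≤ d) (q : ℝ) (hq1 : 1 < q) (hq2 : q < 2)
    (x : Fin d → ℝ) (hx : ∀ i, 0 ≤ x i) (hsum : ∑ i, x i = 1) :
    1 - ∑ i, (x i) ^ q ≥
      ((1 - (d : ℝ) ^ (1 - q)) / ((d : ℝ) - 1) ^ 2) *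
        ((∑ i, Real.sqrt (x i)) ^ 2 - 1) ^ 2 := by
  have hp : q - 1 ∈ Ioo (0 : ℝ) 1 := ⟨by linarith, by linarith⟩
  have hd' : (2 : ℝ) ≤ d := by exact_mod_cast hd
  have hdi : (0 : ℝ) ≤ (d : ℝ)⁻¹ := by positivity
  have hd1 : (0 : ℝ) < (d : ℝ) - 1 := by linarith
  set T := ((∑ i, Real.sqrt (x i)) ^ 2 - 1) ^ 2 with hT
  set c := T / ((d : ℝ) - 1) ^ 2 with hc
  set R := Real.rpowIntegrand₀₁ (q - 1) with hR
  have hI : ∀ y, 0 ≤ y → IntegrableOn (fun t => R t y) (Ioi 0) := fun y hy =>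
    Real.integrableOn_rpowIntegrand₀₁_Ioi hp hy
  have hC : 0 < ∫ t in Ioi 0, R t 1 := Real.integral_rpowIntegrand₀₁_one_pos hp
  have hE : ∀ y, 0 ≤ y → ∫ t in Ioi 0, R t y = y ^ (q - 1) * ∫ t in Ioi 0, R t 1 := fun y hy =>
    Real.integral_rpowIntegrand₀₁_eq_rpow_mul_const hp hy
  have hnn : 0 ≤ ∫ t in Ioi 0, (R t 1 - ∑ i, x i * R t (x i) - c * (R t 1 - R t (d : ℝ)⁻¹)) := by
    refine setIntegral_nonneg measurableSet_Ioi fun s hs => ?_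
    have hs : 0 < s := hs
    have k := key_cs d x hx hsum s hs
    rw [← hT] at k
    have e1 : R s 1 - ∑ i, x i * R s (x i)
        = s ^ (q - 1) * ((s + 1)⁻¹ * ∑ i, x i * (1 - x i) / (x i + s)) := by
      have : R s 1 = ∑ i, x i * R s 1 := by rw [← Finset.sum_mul, hsum, one_mul]
      rw [this, ← Finset.sum_sub_distrib, Finset.mul_sum, Finset.mul_sum]
      refine Finset.sum_congr rfl fun i _ => ?_
      have h1 := hx i
      have h2 : s + x i ≠ 0 := by positivity
      have h3 : x i + s ≠ 0 := by positivity
      simp only [hR, Real.rpowIntegrand₀₁]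
      field_simp
      ring
    have e2 : c * (R s 1 - R s (d : ℝ)⁻¹)
        = s ^ (q - 1) * ((s + 1)⁻¹ * (T / (((d : ℝ) - 1) * (1 + d * s)))) := by
      simp only [hR, Real.rpowIntegrand₀₁, hc]
      have h3 : s + (d : ℝ)⁻¹ ≠ 0 := by positivity
      have h4 : s + (d : ℝ)⁻¹ = (1 + d * s) / d := by field_simp; ring
      rw [h4]
      field_simp
      ring
    rw [e1, e2, ← mul_sub, ← mul_sub]
    refine mul_nonneg (by positivity) (mul_nonneg (by positivity) (sub_nonneg.2 ?_))
    rw [div_le_iff₀ (by positivity)]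
    exact k
  have hs1 : IntegrableOn (fun t => ∑ i, x i * R t (x i)) (Ioi 0) :=
    integrable_finsetSum _ fun i _ => (hI _ (hx i)).const_mul _
  have hs2 : IntegrableOn (fun t => c * (R t 1 - R t (d : ℝ)⁻¹)) (Ioi 0) :=
    ((hI 1 zero_le_one).sub (hI _ hdi)).const_mul _
  have hs3 : IntegrableOn (fun t => R t 1 - ∑ i, x i * R t (x i)) (Ioi 0) :=
    (hI 1 zero_le_one).sub hs1
  rw [integral_sub hs3 hs2, integral_sub (hI 1 zero_le_one) hs1,
    integral_const_mul, integral_sub (hI 1 zero_le_one) (hI _ hdi),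
    integral_finsetSum _ (fun i _ => (hI _ (hx i)).const_mul _)] at hnn
  simp only [integral_const_mul] at hnn
  rw [hE _ hdi] at hnn
  have e : ∀ i, x i * ∫ t in Ioi 0, R t (x i) = x i ^ q * ∫ t in Ioi 0, R t 1 := by
    intro i
    rw [hE _ (hx i), ← mul_assoc]
    congr 1
    have := Real.rpow_add' (hx i) (y := 1) (z := q - 1) (by linarith)
    rw [Real.rpow_one] at this
    rw [← this]; congr 1; ring
  simp only [e] at hnn
  rw [← Finset.sum_mul, Real.inv_rpow (by positivity), ← Real.rpow_neg (by positivity),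
    neg_sub] at hnn
  have : 0 ≤ (1 - ∑ i, x i ^ q - c * (1 - (d : ℝ) ^ (1 - q))) * ∫ t in Ioi 0, R t 1 := by
    linarith
  have := nonneg_of_mul_nonneg_left this hC
  have e5 : (1 - (d : ℝ) ^ (1 - q)) / ((d : ℝ) - 1) ^ 2 * T = c * (1 - (d : ℝ) ^ (1 - q)) := by
    rw [hc]; ring
  rw [e5]; linarith
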